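/- Let v be harmonic on the ball B_1(0) \subset \mathbf{R}^n with \int_{B_1}|v|^2 \le 1. There exists a constant \eta = \eta(n) > 0 such that for every function l : \mathbf{R}^n \to \mathbf{R} whose graph is a union of two half-hyperplanes meeting along an (n-1)-dimensional axis (i.e. l(x) = a_1 + b_1\cdot x on one closed half-space and l(x) = a_2 + b_2 \cdot x on the complementary closed half-space, continuous across the common boundary hyperplane), one has \eta \int_{B_1} |v(x) - (v(0) + Dv(0)\cdot x)|^2 dx \le \int_{B_1} |v(x) - l(x)|^2 dx. -/

import Mathlib

open Metric MeasureTheory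
open scoped RealInnerProductSpace

namespace S11

/-- Abbreviation for Euclidean space. -/
abbrev EE (n : ℕ) := EuclideanSpace ℝ (Fin n)

lemma pos3_deriv (x : ℝ) : HasDerivAt (fun x : ℝ => (max x 0) ^ 3) (3 * (max x 0) ^ 2) x := by
  rcases lt_trichotomy x 0 with h | h | h
  · rw [max_eq_right h.le]
    have : (fun x : ℝ => (max x 0) ^ 3) =ᶠ[nhds x] fun _ => 0 := by
      filter_upwards [Iio_mem_nhds h] with y hy
      rw [max_eq_right (le_of_lt hy)]; norm_num
    simpa using (hasDerivAt_const x (0 : ℝ)).congr_of_eventuallyEq this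
  · subst h
    rw [hasDerivAt_iff_isLittleO_nhds_zero]
    simp only [zero_add, max_self]
    refine Asymptotics.IsLittleO.of_bound fun c hc => ?_
    have : Set.Ioo (-(min c 1)) (min c 1) ∈ nhds (0 : ℝ) := Ioo_mem_nhds (by simp [hc]) (by simp [hc])
    filter_upwards [this] with h hh
    have h1 : max h 0 ≤ |h| := max_le (le_abs_self h) (abs_nonneg h)
    have h2 : |h| < min c 1 := abs_lt.2 hh
    have h3 : |h| < c := lt_of_lt_of_le h2 (min_le_left _ _)
    have h4 : |h| < 1 := lt_of_lt_of_le h2 (min_le_right _ _)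
    have h0 : 0 ≤ max h 0 := le_max_right _ _
    have h5 : (max h 0)^3 ≤ |h|^3 := by gcongr
    simp only [Real.norm_eq_abs]
    norm_num
    rw [abs_of_nonneg h0]
    have := abs_nonneg h
    nlinarith [mul_nonneg this this]
  · rw [max_eq_left h.le]
    have : (fun x : ℝ => (max x 0) ^ 3) =ᶠ[nhds x] fun y => y ^ 3 := by
      filter_upwards [Ioi_mem_nhds h] with y hy
      rw [max_eq_left (le_of_lt hy)]
    simpa using (hasDerivAt_pow 3 x).congr_of_eventuallyEq this

lemma pos2_deriv (x : ℝ) : HasDerivAt (fun x : ℝ => (max x 0) ^ 2) (2 * (max x 0)) x := by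
  rcases lt_trichotomy x 0 with h | h | h
  · rw [max_eq_right h.le]
    have : (fun x : ℝ => (max x 0) ^ 2) =ᶠ[nhds x] fun _ => 0 := by
      filter_upwards [Iio_mem_nhds h] with y hy
      rw [max_eq_right (le_of_lt hy)]; norm_num
    simpa using (hasDerivAt_const x (0 : ℝ)).congr_of_eventuallyEq this
  · subst h
    rw [hasDerivAt_iff_isLittleO_nhds_zero]
    simp only [zero_add, max_self]
    refine Asymptotics.IsLittleO.of_bound fun c hc => ?_
    have : Set.Ioo (-c) c ∈ nhds (0 : ℝ) := Ioo_mem_nhds (by simp [hc]) (by simp [hc])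
    filter_upwards [this] with h hh
    have h1 : max h 0 ≤ |h| := max_le (le_abs_self h) (abs_nonneg h)
    have h3 : |h| < c := abs_lt.2 hh
    have h0 : 0 ≤ max h 0 := le_max_right _ _
    have h5 : (max h 0)^2 ≤ |h|^2 := by gcongr
    simp only [Real.norm_eq_abs]
    norm_num
    have := abs_nonneg h
    nlinarith [mul_nonneg this this]
  · rw [max_eq_left h.le]
    have : (fun x : ℝ => (max x 0) ^ 2) =ᶠ[nhds x] fun y => y ^ 2 := by
      filter_upwards [Ioi_mem_nhds h] with y hy
      rw [max_eq_left (le_of_lt hy)]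
    simpa using (hasDerivAt_pow 2 x).congr_of_eventuallyEq this

/-- positive part of `1 - |y|²` -/
noncomputable def psi {n : ℕ} (y : EE n) : ℝ := max (1 - ‖y‖ ^ 2) 0

lemma psi_cont {n : ℕ} : Continuous (psi (n := n)) := by
  unfold psi; fun_prop

lemma psi_nonneg {n : ℕ} (y : EE n) : 0 ≤ psi y := le_max_right _ _

lemma psi_le_one {n : ℕ} (y : EE n) : psi y ≤ 1 := max_le (by nlinarith [sq_nonneg ‖y‖]) (by norm_num)

lemma psi_zero {n : ℕ} {y : EE n} (h : y ∉ ball (0 : EE n) 1) : psi y = 0 := by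
  have : 1 ≤ ‖y‖ := by simpa using h
  exact max_eq_right (by nlinarith)

lemma psi_comp {n : ℕ} {f : EE n → ℝ} (h : ∀ y, psi y = 0 → f y = 0) : HasCompactSupport f := by
  refine HasCompactSupport.intro (isCompact_closedBall (0 : EE n) 1) fun x hx => h x (psi_zero ?_)
  intro h; exact hx (ball_subset_closedBall h)

lemma q_deriv {n : ℕ} (y : EE n) :
    HasFDerivAt (fun y : EE n => 1 - ‖y‖ ^ 2) (-(2 • innerSL ℝ y)) y := by
  have := (hasStrictFDerivAt_norm_sq y).hasFDerivAt.const_sub 1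
  simpa using this

lemma Phi_deriv {n : ℕ} (y : EE n) :
    HasFDerivAt (fun y : EE n => psi y ^ 3) ((-6 * psi y ^ 2) • innerSL ℝ y) y := by
  have := (pos3_deriv (1 - ‖y‖ ^ 2)).comp_hasFDerivAt y (q_deriv y)
  refine this.congr_fderiv ?_
  ext u
  simp [psi]; ring

lemma phi_deriv {n : ℕ} (y : EE n) :
    HasFDerivAt (fun y : EE n => psi y ^ 2) ((-4 * psi y) • innerSL ℝ y) y := by
  have := (pos2_deriv (1 - ‖y‖ ^ 2)).comp_hasFDerivAt y (q_deriv y)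
  refine this.congr_fderiv ?_
  ext u
  simp [psi]; ring

/-- first derivative of `psi ^ 3` -/
noncomputable def dPhi {n : ℕ} (u y : EE n) : ℝ := -6 * ⟪y, u⟫ * psi y ^ 2

/-- second derivative of `psi ^ 3` -/
noncomputable def ddPhi {n : ℕ} (u y : EE n) : ℝ := -6 * ‖u‖ ^ 2 * psi y ^ 2 + 24 * ⟪y, u⟫ ^ 2 * psi y

lemma dPhi_cont {n : ℕ} (u : EE n) : Continuous (dPhi u) := by
  have := psi_cont (n := n)
  unfold dPhi; fun_prop

lemma ddPhi_cont {n : ℕ} (u : EE n) : Continuous (ddPhi u) := by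
  have := psi_cont (n := n)
  unfold ddPhi; fun_prop

lemma Phi_fderiv {n : ℕ} (u y : EE n) : fderiv ℝ (fun y : EE n => psi y ^ 3) y u = dPhi u y := by
  rw [(Phi_deriv y).fderiv]; simp [dPhi]; ring

lemma dPhi_deriv {n : ℕ} (u y : EE n) : HasFDerivAt (dPhi u)
    ((-6 * psi y ^ 2) • innerSL ℝ u + (24 * ⟪y, u⟫ * psi y) • innerSL ℝ y) y := by
  have h1 : HasFDerivAt (fun y : EE n => -6 * ⟪y, u⟫) ((-6 : ℝ) • innerSL ℝ u) y := by
    have := ((innerSL ℝ u).hasFDerivAt (x := y)).const_mul (-6)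
    refine this.congr_of_eventuallyEq (Filter.Eventually.of_forall fun z => ?_)
    simp [real_inner_comm]
  have := h1.mul (phi_deriv y)
  refine this.congr_fderiv ?_
  ext w
  simp; ring

lemma dPhi_fderiv {n : ℕ} (u y : EE n) : fderiv ℝ (dPhi u) y u = ddPhi u y := by
  rw [(dPhi_deriv u y).fderiv]; simp [ddPhi]; ring

lemma dPhi_contDiff {n : ℕ} (u : EE n) : ContDiff ℝ 1 (dPhi u) := by
  rw [contDiff_one_iff_fderiv]
  refine ⟨fun y => (dPhi_deriv u y).differentiableAt, ?_⟩
  have : fderiv ℝ (dPhi u) = fun y => ((-6 * psi y ^ 2) • innerSL ℝ u + (24 * ⟪y, u⟫ * psi y) • innerSL ℝ y) :=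
    funext fun y => (dPhi_deriv u y).fderiv
  rw [this]
  have := psi_cont (n := n)
  fun_prop

lemma phi_contDiff {n : ℕ} : ContDiff ℝ 1 (fun y : EE n => psi y ^ 2) := by
  rw [contDiff_one_iff_fderiv]
  refine ⟨fun y => (phi_deriv y).differentiableAt, ?_⟩
  have : fderiv ℝ (fun y : EE n => psi y ^ 2) = fun y => (-4 * psi y) • innerSL ℝ y :=
    funext fun y => (phi_deriv y).fderiv
  rw [this]
  have := psi_cont (n := n)
  fun_prop

/-- integration by parts against compactly supported functions -/
lemma ibp {n : ℕ} {f g : EE n → ℝ} (u : EE n) {f' g' : EE n → ℝ} (hf : Differentiable ℝ f)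
    (hf' : ∀ y, fderiv ℝ f y u = f' y) (cf' : Continuous f')
    (hg : Differentiable ℝ g) (hg' : ∀ y, fderiv ℝ g y u = g' y) (cg' : Continuous g')
    (cs : HasCompactSupport g) (cs' : HasCompactSupport g') :
    ∫ y, f y * g' y = - ∫ y, f' y * g y := by
  have := integral_mul_fderiv_eq_neg_fderiv_mul_of_integrable (μ := (volume : Measure (EE n)))
    (f := f) (g := g) (v := u) ?_ ?_ ?_ (fun x _ => hf x) (fun x _ => hg x)
  · simpa only [hf', hg'] using this
  · simp only [hf']
    exact (cf'.mul hg.continuous).integrable_of_hasCompactSupport cs.mul_left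
  · simp only [hg']
    exact (hf.continuous.mul cg').integrable_of_hasCompactSupport cs'.mul_left
  · exact (hf.continuous.mul hg.continuous).integrable_of_hasCompactSupport cs.mul_left

lemma aff_deriv {n : ℕ} (p : EE n) (S : EE n →L[ℝ] EE n) (y : EE n) :
    HasFDerivAt (fun y => p + S y) S y := (S.hasFDerivAt).const_add p

lemma comp_deriv {n : ℕ} {F : EE n → ℝ} (hF : ContDiff ℝ 2 F) (p : EE n) (S : EE n →L[ℝ] EE n) (y : EE n) :
    HasFDerivAt (fun y => F (p + S y)) ((fderiv ℝ F (p + S y)).comp S) y :=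
  ((hF.differentiable (by norm_num)) _).hasFDerivAt.comp y (aff_deriv p S y)

lemma comp_dderiv {n : ℕ} {F : EE n → ℝ} (hF : ContDiff ℝ 2 F) (p w : EE n) (S : EE n →L[ℝ] EE n) (y : EE n) :
    HasFDerivAt (fun y => fderiv ℝ F (p + S y) w)
      (((ContinuousLinearMap.apply ℝ ℝ w).comp (fderiv ℝ (fderiv ℝ F) (p + S y))).comp S) y := by
  have h1 : ContDiff ℝ 1 (fderiv ℝ F) := hF.fderiv_right (by norm_num)
  have h2 := ((h1.differentiable (by norm_num)) (p + S y)).hasFDerivAt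
  have h3 := ((ContinuousLinearMap.apply ℝ ℝ w).hasFDerivAt (x := fderiv ℝ F (p + S y))).comp _ h2
  exact h3.comp y (aff_deriv p S y)

lemma cont_dd {n : ℕ} {F : EE n → ℝ} (hF : ContDiff ℝ 2 F) (p w u : EE n) (S : EE n →L[ℝ] EE n) :
    Continuous fun y => fderiv ℝ (fderiv ℝ F) (p + S y) u w := by
  have h1 : ContDiff ℝ 1 (fderiv ℝ F) := hF.fderiv_right (by norm_num)
  have h2 := h1.continuous_fderiv (by norm_num)
  fun_prop

lemma cont_d {n : ℕ} {F : EE n → ℝ} (hF : ContDiff ℝ 2 F) (p w : EE n) (S : EE n →L[ℝ] EE n) :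
    Continuous fun y => fderiv ℝ F (p + S y) w := by
  have h2 := hF.continuous_fderiv (by norm_num)
  fun_prop

lemma green1 {n : ℕ} {F : EE n → ℝ} (hF : ContDiff ℝ 2 F) (p w u : EE n) (S : EE n →L[ℝ] EE n) :
    ∫ y, fderiv ℝ F (p + S y) w * dPhi u y
      = - ∫ y, fderiv ℝ (fderiv ℝ F) (p + S y) (S u) w * psi y ^ 3 := by
  refine ibp u (fun y => (comp_dderiv hF p w S y).differentiableAt)
    (fun y => ?_) (cont_dd hF _ _ _ _) (fun y => (Phi_deriv y).differentiableAt)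
    (fun y => Phi_fderiv u y) (dPhi_cont u) (psi_comp ?_) (psi_comp ?_)
  · rw [(comp_dderiv hF p w S y).fderiv]; simp
  · intro y h; simp [h]
  · intro y h; simp [h, dPhi]

lemma green2 {n : ℕ} {F : EE n → ℝ} (hF : ContDiff ℝ 2 F) (p u : EE n) (S : EE n →L[ℝ] EE n) :
    ∫ y, F (p + S y) * ddPhi u y
      = ∫ y, fderiv ℝ (fderiv ℝ F) (p + S y) (S u) (S u) * psi y ^ 3 := by
  have := green1 hF p (S u) u S
  rw [← neg_eq_iff_eq_neg] at this
  rw [← this]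
  refine ibp u (fun y => (comp_deriv hF p S y).differentiableAt)
    (fun y => ?_) (cont_d hF _ _ _) (fun y => (dPhi_deriv u y).differentiableAt)
    (fun y => dPhi_fderiv u y) (ddPhi_cont u) (psi_comp ?_) (psi_comp ?_)
  · rw [(comp_deriv hF p S y).fderiv]; simp
  · intro y h; simp [h, dPhi]
  · intro y h; simp [h, ddPhi]
end S11

namespace S11

/-- `C²` and harmonic on the unit ball -/
def Harm {n : ℕ} (h : EE n → ℝ) : Prop :=
  ContDiffOn ℝ 2 h (ball 0 1) ∧ ∀ x ∈ ball (0 : EE n) 1, ∑ i : Fin n,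
    fderiv ℝ (fderiv ℝ h) x (EuclideanSpace.single i 1) (EuclideanSpace.single i 1) = 0

lemma Harm.ext {n : ℕ} {h : EE n → ℝ} (hh : Harm h) {ρ : ℝ} (h0 : 0 < ρ) (h1 : ρ < 1) :
    ∃ F : EE n → ℝ, ContDiff ℝ 2 F ∧ (∀ x ∈ ball (0 : EE n) ρ, F x = h x) ∧
      ∀ x ∈ ball (0 : EE n) ρ, ∑ i : Fin n,
    fderiv ℝ (fderiv ℝ F) x (EuclideanSpace.single i 1) (EuclideanSpace.single i 1) = 0 := by
  let χ : ContDiffBump (0 : EE n) := ⟨ρ, (ρ + 1) / 2, h0, by linarith⟩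
  have heq : ∀ x ∈ ball (0 : EE n) ρ, χ x * h x = h x := by
    intro x hx
    rw [χ.one_of_mem_closedBall (ball_subset_closedBall hx), one_mul]
  refine ⟨fun x => χ x * h x, ?_, heq, ?_⟩
  · rw [contDiff_iff_contDiffAt]
    intro x
    by_cases hx : x ∈ ball (0 : EE n) 1
    · have := hh.1.contDiffAt (isOpen_ball.mem_nhds hx)
      exact (χ.contDiff (n := 2)).contDiffAt.mul this
    · have : (fun x => χ x * h x) =ᶠ[nhds x] fun _ => 0 := by
        have hx' : x ∈ (closedBall (0 : EE n) ((ρ + 1) / 2))ᶜ := by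
          simp at hx ⊢; linarith
        filter_upwards [isClosed_closedBall.isOpen_compl.mem_nhds hx'] with y hy
        rw [χ.zero_of_le_dist, zero_mul]
        simp at hy
        simpa using hy.le
      exact contDiffAt_const.congr_of_eventuallyEq this
  · intro x hx
    have e1 : (fun x => χ x * h x) =ᶠ[nhds x] h := by
      filter_upwards [isOpen_ball.mem_nhds hx] with y hy using heq y hy
    have e2 := e1.fderiv (𝕜 := ℝ)
    rw [e2.fderiv_eq]
    exact hh.2 x (ball_subset_ball h1.le hx)

lemma sum_single {n : ℕ} (y : EE n) : y = ∑ i : Fin n, ⟪y, EuclideanSpace.single i (1:ℝ)⟫ • EuclideanSpace.single i (1:ℝ) := by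
  ext j
  simp [EuclideanSpace.inner_single_right, Finset.sum_apply, Pi.single_apply]

lemma m_deriv {n : ℕ} {F : EE n → ℝ} (hF : ContDiff ℝ 2 F) (z : EE n) (r : ℝ) :
    HasDerivAt (fun r : ℝ => ∫ y, F (z + r • y) * psi y ^ 2)
      (∫ y, fderiv ℝ F (z + r • y) y * psi y ^ 2) r := by
  have hd := hF.differentiable (by norm_num)
  have hc := hF.continuous_fderiv (by norm_num)
  have hF0 := hF.continuous
  have hps := psi_cont (n := n)
  obtain ⟨C, hC⟩ := (isCompact_closedBall z (|r| + 1)).exists_bound_of_continuousOn hc.continuousOn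
  refine (hasDerivAt_integral_of_dominated_loc_of_deriv_le
    (bound := fun y => C * psi y ^ 2) (F := fun (r : ℝ) y => F (z + r • y) * psi y ^ 2)
    (F' := fun (r : ℝ) y => fderiv ℝ F (z + r • y) y * psi y ^ 2)
    (ball_mem_nhds r one_pos) ?_ ?_ ?_ ?_ ?_ ?_).2
  · refine Filter.Eventually.of_forall fun s => ?_
    have : Continuous fun y => F (z + s • y) * psi y ^ 2 := by fun_prop
    exact this.aestronglyMeasurable
  · have : Continuous fun y => F (z + r • y) * psi y ^ 2 := by fun_prop
    exact this.integrable_of_hasCompactSupport (psi_comp fun y h => by simp [h])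
  · have : Continuous fun y => fderiv ℝ F (z + r • y) y * psi y ^ 2 := by fun_prop
    exact this.aestronglyMeasurable
  · refine Filter.Eventually.of_forall fun y s hs => ?_
    by_cases hy : y ∈ ball (0 : EE n) 1
    · rw [norm_mul, Real.norm_of_nonneg (sq_nonneg (psi y))]
      gcongr
      have hy1 : ‖y‖ < 1 := by simpa using hy
      have hs1 : |s - r| < 1 := by simpa [Real.dist_eq] using hs
      have hs2 : |s| ≤ |r| + 1 := by
        have := abs_sub_abs_le_abs_sub s r
        linarith
      have := hC (z + s • y) (by
        simp [norm_smul]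
        nlinarith [abs_nonneg s, norm_nonneg y])
      calc ‖fderiv ℝ F (z + s • y) y‖ ≤ ‖fderiv ℝ F (z + s • y)‖ * ‖y‖ := ContinuousLinearMap.le_opNorm _ _
        _ ≤ ‖fderiv ℝ F (z + s • y)‖ * 1 := by gcongr
        _ ≤ C := by linarith
    · simp [psi_zero hy]
  · have : Continuous fun y : EE n => C * psi y ^ 2 := by fun_prop
    exact this.integrable_of_hasCompactSupport (psi_comp fun y h => by simp [h])
  · refine Filter.Eventually.of_forall fun y s hs => ?_
    have h1 : HasDerivAt (fun s : ℝ => z + s • y) y s := by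
      simpa using ((hasDerivAt_id s).smul_const y).const_add z
    exact ((hd (z + s • y)).hasFDerivAt.comp_hasDerivAt s h1).mul_const _

lemma mean_value {n : ℕ} {F : EE n → ℝ} (hF : ContDiff ℝ 2 F) (z : EE n) {R : ℝ} (hR : 0 < R)
    (hL : ∀ x ∈ ball z R, ∑ i : Fin n,
      fderiv ℝ (fderiv ℝ F) x (EuclideanSpace.single i 1) (EuclideanSpace.single i 1) = 0) :
    ∫ y, F (z + R • y) * psi y ^ 2 = F z * ∫ y : EE n, psi y ^ 2 := by
  have hps := psi_cont (n := n)
  have key : ∀ r ∈ Set.Ico 0 R, (∫ y, fderiv ℝ F (z + r • y) y * psi y ^ 2) = 0 := by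
    intro r hr
    let S : EE n →L[ℝ] EE n := r • ContinuousLinearMap.id ℝ (EE n)
    have hS : ∀ y, S y = r • y := fun y => by simp [S]
    have e1 : ∀ y : EE n, fderiv ℝ F (z + r • y) y * psi y ^ 2 =
        ∑ i : Fin n, (-1/6) * (fderiv ℝ F (z + S y) (EuclideanSpace.single i 1) * dPhi (EuclideanSpace.single i 1) y) := by
      intro y
      rw [hS]
      conv_lhs => rw [show fderiv ℝ F (z + r • y) y = fderiv ℝ F (z + r • y) (∑ i : Fin n, ⟪y, EuclideanSpace.single i (1:ℝ)⟫ • EuclideanSpace.single i (1:ℝ)) by rw [← sum_single y]]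
      rw [map_sum, Finset.sum_mul]
      refine Finset.sum_congr rfl fun i _ => ?_
      rw [map_smul, dPhi, smul_eq_mul]; ring
    simp_rw [e1]
    have int1 : ∀ i : Fin n, Integrable fun y => fderiv ℝ F (z + S y) (EuclideanSpace.single i 1) * dPhi (EuclideanSpace.single i 1) y := fun i =>
      ((cont_d hF _ _ _).mul (dPhi_cont _)).integrable_of_hasCompactSupport (psi_comp fun y h => by simp [h, dPhi])
    rw [integral_finsetSum _ fun i _ => (int1 i).const_mul _]
    simp_rw [integral_const_mul, green1 hF]
    rw [← Finset.mul_sum, Finset.sum_neg_distrib, ← integral_finsetSum]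
    · have : ∀ y : EE n, ∑ i : Fin n, fderiv ℝ (fderiv ℝ F) (z + S y) (S (EuclideanSpace.single i 1)) (EuclideanSpace.single i 1) * psi y ^ 3 = 0 := by
        intro y
        by_cases hy : y ∈ ball (0 : EE n) 1
        · rw [← Finset.sum_mul]
          simp_rw [hS, map_smul]
          simp only [ContinuousLinearMap.smul_apply, smul_eq_mul]
          rw [← Finset.mul_sum, hL]
          · ring
          · have hy1 : ‖y‖ < 1 := by simpa using hy
            simp only [mem_ball, dist_self_add_left, norm_smul, Real.norm_eq_abs, abs_of_nonneg hr.1]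
            nlinarith [hr.1, hr.2, norm_nonneg y]
        · simp [psi_zero hy]
      simp [this]
    · intro i _
      exact ((cont_dd hF _ _ _ _).mul (hps.pow 3)).integrable_of_hasCompactSupport (psi_comp fun y h => by simp [h])
  have := constant_of_has_deriv_right_zero (f := fun r : ℝ => ∫ y, F (z + r • y) * psi y ^ 2) (a := 0) (b := R)
    (fun r _ => (m_deriv hF z r).continuousAt.continuousWithinAt)
    (fun r hr => by
      have h := (m_deriv hF z r).hasDerivWithinAt (s := Set.Ici r)
      rwa [key r hr] at h) R ⟨hR.le, le_rfl⟩
  simp only [zero_smul, add_zero] at this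
  rw [this, integral_const_mul]

lemma phi_int_pos {n : ℕ} : 0 < ∫ y : EE n, psi y ^ 2 := by
  have hps := psi_cont (n := n)
  refine Continuous.integral_pos_of_hasCompactSupport_nonneg_nonzero (x := 0) (hps.pow 2) (psi_comp fun y h => by simp [h]) (fun y => sq_nonneg _) ?_
  simp [psi]

end S11

namespace S11

instance ball_fin {n : ℕ} : IsFiniteMeasure (volume.restrict (ball (0 : EE n) 1)) :=
  ⟨by simpa using measure_ball_lt_top⟩

lemma cs {α : Type*} [MeasurableSpace α] {μ : Measure α} [IsFiniteMeasure μ] {f : α → ℝ}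
    (hf : MemLp f 2 μ) : (∫ x, |f x| ∂μ) ^ 2 ≤ μ.real Set.univ * ∫ x, f x ^ 2 ∂μ := by
  set V := μ.real Set.univ with hV
  set I := ∫ x, |f x| ∂μ with hI
  have hV0 : 0 ≤ V := measureReal_nonneg
  have i2 : Integrable (fun x => f x ^ 2) μ := hf.integrable_sq
  have i1 : Integrable (fun x => |f x|) μ := (hf.integrable (by norm_num)).abs
  have h0 : 0 ≤ ∫ x, (V * |f x| - I) ^ 2 ∂μ := integral_nonneg fun x => sq_nonneg _
  have e : ∫ x, (V * |f x| - I) ^ 2 ∂μ = V ^ 2 * (∫ x, f x ^ 2 ∂μ) - 2 * V * I * I + V * I ^ 2 := by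
    have : ∀ x, (V * |f x| - I) ^ 2 = V ^ 2 * f x ^ 2 - (2 * V * I) * |f x| + I ^ 2 := by
      intro x; rw [← sq_abs (f x)]; ring
    simp_rw [this]
    have i3 : Integrable (fun x => V ^ 2 * f x ^ 2 - (2 * V * I) * |f x|) μ := (i2.const_mul _).sub (i1.const_mul _)
    rw [integral_add i3 (integrable_const _),
      integral_sub (i2.const_mul _) (i1.const_mul _), integral_const_mul, integral_const_mul]
    simp [hV, hI]
  rw [e] at h0
  rcases hV0.eq_or_lt with h | h
  · have : μ = 0 := by
      rw [← Measure.measure_univ_eq_zero]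
      have := h.symm
      rw [hV, measureReal_eq_zero_iff] at this
      exact this
    simp [hI, this]
  · have : 0 ≤ V * (V * (∫ x, f x ^ 2 ∂μ) - I ^ 2) := by nlinarith
    have := nonneg_of_mul_nonneg_right this h
    linarith

lemma Harm.memLp {n : ℕ} {h : EE n → ℝ} (hh : Harm h)
    (hi : Integrable (fun x => h x ^ 2) (volume.restrict (ball (0 : EE n) 1))) :
    MemLp h 2 (volume.restrict (ball (0 : EE n) 1)) := by
  rw [memLp_two_iff_integrable_sq]
  · exact hi
  · exact hh.1.continuousOn.aestronglyMeasurable measurableSet_ball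

lemma rep {n : ℕ} {F : EE n → ℝ} (hF : ContDiff ℝ 2 F)
    (hL : ∀ x ∈ ball (0 : EE n) (7/8), ∑ i : Fin n,
      fderiv ℝ (fderiv ℝ F) x (EuclideanSpace.single i 1) (EuclideanSpace.single i 1) = 0)
    {z : EE n} (hz : ‖z‖ ≤ 1 / 2) :
    F z * (∫ y : EE n, psi y ^ 2) = 4 ^ n * ∫ x, F x * psi ((4 : ℝ) • (x - z)) ^ 2 := by
  rw [← mean_value hF z (R := 1/4) (by norm_num)]
  · have h1 := Measure.integral_comp_smul (volume : Measure (EE n)) (fun x => F (z + x) * psi ((4:ℝ) • x) ^ 2) (1/4)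
    have h2 := integral_sub_right_eq_self (μ := (volume : Measure (EE n))) (fun x => F (z + x) * psi ((4:ℝ) • x) ^ 2) z
    simp only [add_sub_cancel] at h2
    rw [h2]
    simp only [smul_smul] at h1
    norm_num at h1
    norm_num
    rw [h1, one_div, inv_pow, inv_inv]
  · intro x hx
    apply hL
    rw [mem_ball, dist_eq_norm] at hx
    rw [mem_ball_zero_iff]
    calc ‖x‖ = ‖(x - z) + z‖ := by simp
      _ ≤ ‖x - z‖ + ‖z‖ := norm_add_le _ _
      _ < 7/8 := by linarith

lemma interior {n : ℕ} : ∃ C : ℝ, 0 < C ∧ ∀ h : EE n → ℝ, Harm h →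
    Integrable (fun x => h x ^ 2) (volume.restrict (ball (0 : EE n) 1)) →
    |h 0| ≤ C * (∫ x in ball (0 : EE n) 1, |h x|) ∧
    ‖fderiv ℝ h 0‖ ≤ C * (∫ x in ball (0 : EE n) 1, |h x|) := by
  have hps := psi_cont (n := n)
  obtain ⟨K, hK⟩ := ContDiff.lipschitzWith_of_hasCompactSupport
    (psi_comp fun y h => by simp [h]) (phi_contDiff (n := n)) (by norm_num)
  set c := ∫ y : EE n, psi y ^ 2 with hc
  have hc0 : 0 < c := phi_int_pos
  refine ⟨4 ^ n * (4 * K + 1) / c, by positivity, fun h hh hi => ?_⟩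
  set I := ∫ x in ball (0 : EE n) 1, |h x| with hI
  have hI0 : 0 ≤ I := integral_nonneg fun x => abs_nonneg _
  have hml := hh.memLp hi
  have hintg : Integrable (fun x => |h x|) (volume.restrict (ball (0 : EE n) 1)) :=
    (hml.integrable (by norm_num)).abs
  obtain ⟨F, hF, hFe, hL⟩ := hh.ext (ρ := 7/8) (by norm_num) (by norm_num)
  have hFc := hF.continuous
  -- general bound
  have gen : ∀ (k : EE n → ℝ) (A : ℝ), 0 ≤ A → (∀ x, |k x| ≤ A) →
      (∀ x, x ∉ ball (0 : EE n) (7/8) → k x = 0) → |∫ x, F x * k x| ≤ A * I := by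
    intro k A hA hk hk0
    have hi2 : Integrable ((ball (0 : EE n) 1).indicator fun x => A * |h x|) volume :=
      (integrable_indicator_iff measurableSet_ball).2 (hintg.const_mul A)
    have := norm_integral_le_of_norm_le (f := fun x => F x * k x) hi2 (Filter.Eventually.of_forall fun x => ?_)
    · rw [integral_indicator measurableSet_ball, integral_const_mul] at this
      exact this
    · by_cases hx : x ∈ ball (0 : EE n) (7/8)
      · have hx1 : x ∈ ball (0 : EE n) 1 := ball_subset_ball (by norm_num) hx
        rw [Set.indicator_of_mem hx1, hFe x hx, norm_mul, mul_comm]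
        exact mul_le_mul_of_nonneg_right (hk x) (abs_nonneg _)
      · rw [hk0 x hx, mul_zero, norm_zero]
        exact Set.indicator_nonneg (fun x _ => by positivity) _
  have psi0 : ∀ z x : EE n, ‖z‖ ≤ 1/2 → x ∉ ball (0 : EE n) (7/8) → psi ((4:ℝ) • (x - z)) = 0 := by
    intro z x hz hx
    apply psi_zero
    simp only [mem_ball_zero_iff, not_lt, norm_smul] at hx ⊢
    have := norm_sub_norm_le x z
    norm_num
    linarith
  have h00 : F 0 = h 0 := hFe 0 (by simp)
  have r0 := rep hF hL (z := 0) (by simp)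
  have cint : ∀ z : EE n, ‖z‖ ≤ 1/2 → Integrable (fun x => F x * psi ((4:ℝ) • (x - z)) ^ 2) := by
    intro z hz
    refine Continuous.integrable_of_hasCompactSupport (by fun_prop) ?_
    refine HasCompactSupport.intro (isCompact_closedBall (0 : EE n) (7/8)) fun x hx => ?_
    rw [psi0 z x hz (fun h => hx (ball_subset_closedBall h))]; simp
  constructor
  · rw [div_mul_eq_mul_div, le_div_iff₀ hc0, ← h00]
    calc |F 0| * c = |F 0 * c| := by rw [abs_mul, abs_of_pos hc0]
      _ = 4 ^ n * |∫ x, F x * psi ((4:ℝ) • (x - 0)) ^ 2| := by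
        rw [r0, abs_mul, abs_of_pos (by positivity)]
      _ ≤ 4 ^ n * (1 * I) := by
        gcongr
        apply gen _ 1 zero_le_one
        · intro x
          rw [abs_of_nonneg (sq_nonneg _)]
          exact pow_le_one₀ (psi_nonneg _) (psi_le_one _)
        · intro x hx
          rw [psi0 0 x (by simp) hx]; simp
      _ ≤ _ := by
        rw [mul_assoc]
        gcongr
        linarith [K.2]
  · have hd : HasFDerivAt h (fderiv ℝ h 0) 0 :=
      ((hh.1.contDiffAt (isOpen_ball.mem_nhds (by simp))).differentiableAt (by norm_num)).hasFDerivAt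
    refine hd.le_of_lip' (by positivity) ?_
    filter_upwards [ball_mem_nhds (0 : EE n) (show (0:ℝ) < 1/2 by norm_num)] with z hz
    have hz1 : ‖z‖ < 1/2 := by simpa using hz
    have hz2 : F z = h z := hFe z (by simp; linarith)
    rw [div_mul_eq_mul_div, div_mul_eq_mul_div, le_div_iff₀ hc0, ← h00, ← hz2, Real.norm_eq_abs, sub_zero]
    calc |F z - F 0| * c = |F z * c - F 0 * c| := by rw [← sub_mul, abs_mul, abs_of_pos hc0]
      _ = 4 ^ n * |∫ x, F x * (psi ((4:ℝ) • (x - z)) ^ 2 - psi ((4:ℝ) • (x - 0)) ^ 2)| := by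
        rw [rep hF hL hz1.le, r0, ← mul_sub, abs_mul, abs_of_pos (by positivity : (0:ℝ) < 4 ^ n),
          ← integral_sub (cint z hz1.le) (cint 0 (by simp))]
        simp only [mul_sub]
      _ ≤ 4 ^ n * ((4 * K * ‖z‖) * I) := by
        gcongr
        apply gen _ _ (by positivity)
        · intro x
          have := hK.dist_le_mul ((4:ℝ) • (x - z)) ((4:ℝ) • (x - 0))
          rw [Real.dist_eq, dist_eq_norm, ← smul_sub, norm_smul] at this
          simp at this ⊢
          linarith
        · intro x hx
          rw [psi0 0 x (by simp) hx, psi0 z x hz1.le hx]; simp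
      _ ≤ _ := by
        have : (0:ℝ) ≤ 4 ^ n * I * ‖z‖ := by positivity
        nlinarith

lemma lin_bound {n : ℕ} : ∃ C : ℝ, 0 < C ∧ ∀ h : EE n → ℝ, Harm h →
    Integrable (fun x => h x ^ 2) (volume.restrict (ball (0 : EE n) 1)) →
    ∫ x in ball (0 : EE n) 1, (h x - (h 0 + fderiv ℝ h 0 x)) ^ 2 ≤
      C * ∫ x in ball (0 : EE n) 1, h x ^ 2 := by
  obtain ⟨C, hC, H⟩ := interior (n := n)
  set V := (volume.restrict (ball (0 : EE n) 1)).real Set.univ with hV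
  have hV0 : 0 ≤ V := measureReal_nonneg
  refine ⟨2 + 8 * C ^ 2 * V * V, by positivity, fun h hh hi => ?_⟩
  have hcs := cs (hh.memLp hi)
  obtain ⟨h1, h2⟩ := H h hh hi
  set I := ∫ x in ball (0 : EE n) 1, |h x| with hI
  have hI0 : 0 ≤ I := integral_nonneg fun x => abs_nonneg _
  have : ∫ x in ball (0 : EE n) 1, (h x - (h 0 + fderiv ℝ h 0 x)) ^ 2 ≤
      ∫ x in ball (0 : EE n) 1, (2 * h x ^ 2 + 8 * C ^ 2 * I ^ 2) := by
    refine integral_mono_of_nonneg (Filter.Eventually.of_forall fun x => sq_nonneg _)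
      ((hi.const_mul _).add (integrable_const _)) ?_
    filter_upwards [ae_restrict_mem measurableSet_ball] with x hx
    have hx1 : ‖x‖ < 1 := by simpa using hx
    have h3 : |fderiv ℝ h 0 x| ≤ C * I := by
      have := (fderiv ℝ h 0).le_opNorm x
      rw [Real.norm_eq_abs] at this
      nlinarith [norm_nonneg x, norm_nonneg (fderiv ℝ h 0)]
    have h4 : |h 0 + fderiv ℝ h 0 x| ≤ 2 * (C * I) := (abs_add_le _ _).trans (by linarith)
    have h5 : (h 0 + fderiv ℝ h 0 x) ^ 2 ≤ (2 * (C * I)) ^ 2 := by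
      rw [← sq_abs]; gcongr
    nlinarith [sq_nonneg (h x + (h 0 + fderiv ℝ h 0 x))]
  refine this.trans ?_
  rw [integral_add (hi.const_mul _) (integrable_const _), integral_const_mul]
  simp only [integral_const, smul_eq_mul, ← hV]
  have : 0 ≤ C ^ 2 * V := by positivity
  nlinarith [mul_le_mul_of_nonneg_left hcs this]
end S11

namespace S11

lemma hyper_null {n : ℕ} {ν : EE n} (hν : ‖ν‖ = 1) : ∀ᵐ y : EE n, ⟪y, ν⟫ ≠ 0 := by
  have h := Measure.addHaar_submodule (volume : Measure (EE n)) (LinearMap.ker (innerSL ℝ ν).toLinearMap) ?_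
  · rw [ae_iff]
    convert h using 2
    ext y
    simp [real_inner_comm]
  · intro h
    have : ν ∈ LinearMap.ker (innerSL ℝ ν).toLinearMap := by rw [h]; trivial
    simp at this
    simp [this] at hν

lemma kink {n : ℕ} {ν : EE n} (hν : ‖ν‖ = 1) (u : EE n) :
    ∫ y, max ⟪y, ν⟫ 0 * ddPhi u y =
      6 * ⟪ν, u⟫ * ∫ y, ({y : EE n | 0 < ⟪y, ν⟫}.indicator 1 y) * (⟪y, u⟫ * psi y ^ 2) := by
  obtain ⟨D, hD⟩ := ContDiff.lipschitzWith_of_hasCompactSupport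
    (psi_comp (f := dPhi u) fun y h => by simp [h, dPhi]) (dPhi_contDiff u) (by norm_num)
  have hf : LipschitzWith 1 (fun y : EE n => max ⟪y, ν⟫ 0) := by
    refine LipschitzWith.of_dist_le_mul fun x y => ?_
    rw [Real.dist_eq, dist_eq_norm, NNReal.coe_one, one_mul]
    refine (abs_max_sub_max_le_abs _ _ _).trans ?_
    rw [← inner_sub_left]
    simpa [hν] using abs_real_inner_le_norm (x - y) ν
  have := hf.integral_lineDeriv_mul_eq (μ := (volume : Measure (EE n))) hD
    (psi_comp (f := dPhi u) fun y h => by simp [h, dPhi]) u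
  have e1 : ∀ y, lineDeriv ℝ (dPhi u) y (-u) * max ⟪y, ν⟫ 0 = - (max ⟪y, ν⟫ 0 * ddPhi u y) := by
    intro y
    rw [((dPhi_deriv u y).differentiableAt).lineDeriv_eq_fderiv, map_neg, dPhi_fderiv]; ring
  have e2 : ∫ y, lineDeriv ℝ (fun y : EE n => max ⟪y, ν⟫ 0) y u * dPhi u y =
      ∫ y, (-6 * ⟪ν, u⟫) * (({y : EE n | 0 < ⟪y, ν⟫}.indicator 1 y) * (⟪y, u⟫ * psi y ^ 2)) := by
    refine integral_congr_ae ?_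
    filter_upwards [hyper_null hν] with y hy
    have hin : HasFDerivAt (fun y : EE n => ⟪y, ν⟫) (innerSL ℝ ν) y := by
      refine ((innerSL ℝ ν).hasFDerivAt (x := y)).congr_of_eventuallyEq
        (Filter.Eventually.of_forall fun z => ?_)
      simp [real_inner_comm]
    have hcont : Continuous fun y : EE n => ⟪y, ν⟫ := by fun_prop
    rcases lt_or_gt_of_ne hy with h | h
    · have : HasFDerivAt (fun y : EE n => max ⟪y, ν⟫ 0) (0 : EE n →L[ℝ] ℝ) y := by
        refine (hasFDerivAt_const (0:ℝ) y).congr_of_eventuallyEq ?_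
        filter_upwards [hcont.continuousAt.eventually_lt continuousAt_const h] with z hz
        exact max_eq_right (le_of_lt hz)
      rw [this.differentiableAt.lineDeriv_eq_fderiv, this.fderiv]
      rw [Set.indicator_of_notMem (by simpa using h.le)]
      simp
    · have : HasFDerivAt (fun y : EE n => max ⟪y, ν⟫ 0) (innerSL ℝ ν) y := by
        refine hin.congr_of_eventuallyEq ?_
        filter_upwards [continuousAt_const.eventually_lt hcont.continuousAt h] with z hz
        exact max_eq_left (le_of_lt hz)
      rw [this.differentiableAt.lineDeriv_eq_fderiv, this.fderiv]
      rw [Set.indicator_of_mem (by simpa using h)]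
      simp [dPhi]; ring
  simp_rw [e1] at this
  rw [e2, integral_neg, integral_const_mul] at this
  linarith

/-- the anisotropic operator applied to the test function -/
noncomputable def LPhi {n : ℕ} (ν : EE n) (δ : ℝ) (y : EE n) : ℝ :=
  (1 - δ) * ddPhi ν y + ∑ i : Fin n, δ * ddPhi (EuclideanSpace.single i 1) y

lemma ddPhi_zero {n : ℕ} (u y : EE n) (h : psi y = 0) : ddPhi u y = 0 := by simp [ddPhi, h]

lemma LPhi_zero {n : ℕ} (ν : EE n) (δ : ℝ) (y : EE n) (h : psi y = 0) : LPhi ν δ y = 0 := by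
  simp [LPhi, ddPhi_zero _ y h]

lemma LPhi_cont {n : ℕ} (ν : EE n) (δ : ℝ) : Continuous (LPhi ν δ) := by
  unfold LPhi
  have := fun u : EE n => ddPhi_cont u
  fun_prop

lemma ddPhi_bound {n : ℕ} {u : EE n} (hu : ‖u‖ = 1) (y : EE n) : |ddPhi u y| ≤ 30 := by
  by_cases hy : y ∈ ball (0 : EE n) 1
  · have hy1 : ‖y‖ < 1 := by simpa using hy
    have h1 := abs_real_inner_le_norm y u
    rw [hu, mul_one] at h1
    have h2 : ⟪y, u⟫ ^ 2 ≤ 1 := by rw [← sq_abs]; exact pow_le_one₀ (abs_nonneg _) (by linarith)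
    have h3 := psi_nonneg y
    have h4 := psi_le_one y
    have h5 : psi y ^ 2 ≤ 1 := pow_le_one₀ h3 h4
    have h6 : ⟪y, u⟫ ^ 2 * psi y ≤ 1 := mul_le_one₀ h2 h3 h4
    have h7 : 0 ≤ ⟪y, u⟫ ^ 2 * psi y := by positivity
    have h8 : 0 ≤ psi y ^ 2 := by positivity
    rw [ddPhi, hu, abs_le]
    constructor <;> nlinarith
  · rw [ddPhi_zero _ _ (psi_zero hy)]; norm_num

lemma LPhi_bound {n : ℕ} {ν : EE n} (hν : ‖ν‖ = 1) {δ : ℝ} (h0 : 0 ≤ δ) (h1 : δ ≤ 1) (y : EE n) :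
    |LPhi ν δ y| ≤ 30 + 30 * n := by
  unfold LPhi
  refine (abs_add_le _ _).trans (add_le_add ?_ ?_)
  · rw [abs_mul, abs_of_nonneg (by linarith : 0 ≤ 1 - δ)]
    nlinarith [ddPhi_bound hν y, abs_nonneg (ddPhi ν y)]
  · refine (Finset.abs_sum_le_sum_abs _ _).trans ?_
    calc _ ≤ ∑ i : Fin n, (30 : ℝ) := by
          refine Finset.sum_le_sum fun i _ => ?_
          rw [abs_mul, abs_of_nonneg h0]
          have := ddPhi_bound (u := EuclideanSpace.single i (1:ℝ)) (by simp) y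
          nlinarith [abs_nonneg (ddPhi (EuclideanSpace.single i (1:ℝ)) y)]
      _ = 30 * n := by simp; ring

lemma int_LPhi {n : ℕ} {ν : EE n} {δ : ℝ} {f : EE n → ℝ} (hf : Continuous f) :
    ∫ y, f y * LPhi ν δ y = (1 - δ) * (∫ y, f y * ddPhi ν y) +
      ∑ i : Fin n, δ * ∫ y, f y * ddPhi (EuclideanSpace.single i 1) y := by
  have hi : ∀ u : EE n, Integrable fun y => f y * ddPhi u y := fun u =>
    (hf.mul (ddPhi_cont u)).integrable_of_hasCompactSupport (psi_comp fun y h => by simp [ddPhi_zero _ y h])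
  have : ∀ y, f y * LPhi ν δ y = (1 - δ) * (f y * ddPhi ν y) +
      ∑ i : Fin n, δ * (f y * ddPhi (EuclideanSpace.single i 1) y) := by
    intro y
    rw [LPhi, mul_add, Finset.mul_sum]
    congr 1
    · ring
    · exact Finset.sum_congr rfl fun i _ => by ring
  simp_rw [this]
  rw [integral_add ((hi _).const_mul _) (integrable_finsetSum _ fun i _ => (hi _).const_mul _),
    integral_finsetSum _ fun i _ => (hi _).const_mul _]
  simp_rw [integral_const_mul]

lemma kink_LPhi {n : ℕ} {ν : EE n} (hν : ‖ν‖ = 1) (δ : ℝ) :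
    ∫ y, max ⟪y, ν⟫ 0 * LPhi ν δ y =
      6 * ∫ y, ({y : EE n | 0 < ⟪y, ν⟫}.indicator 1 y) * (⟪y, ν⟫ * psi y ^ 2) := by
  have hps := psi_cont (n := n)
  rw [int_LPhi (by fun_prop)]
  simp_rw [kink hν]
  have hi : ∀ u : EE n, Integrable fun y => ({y : EE n | 0 < ⟪y, ν⟫}.indicator 1 y) * (⟪y, u⟫ * psi y ^ 2) := by
    intro u
    have : Integrable fun y : EE n => ⟪y, u⟫ * psi y ^ 2 :=
      Continuous.integrable_of_hasCompactSupport (by fun_prop) (psi_comp fun y h => by simp [h])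
    have h2 := this.indicator (s := {y : EE n | 0 < ⟪y, ν⟫}) (measurableSet_lt measurable_const (by fun_prop))
    refine h2.congr (Filter.Eventually.of_forall fun y => ?_)
    simp only [Set.indicator_apply]
    split_ifs <;> simp
  have e : ∑ i : Fin n, δ * (6 * ⟪ν, EuclideanSpace.single i (1:ℝ)⟫ *
      ∫ y, ({y : EE n | 0 < ⟪y, ν⟫}.indicator 1 y) * (⟪y, EuclideanSpace.single i (1:ℝ)⟫ * psi y ^ 2)) =
      δ * (6 * ∫ y, ({y : EE n | 0 < ⟪y, ν⟫}.indicator 1 y) * (⟪y, ν⟫ * psi y ^ 2)) := by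
    rw [← Finset.mul_sum]
    congr 1
    simp_rw [mul_assoc, ← integral_const_mul, ]
    rw [← integral_finsetSum]
    · refine integral_congr_ae (Filter.Eventually.of_forall fun y => ?_)
      simp only
      conv_rhs => rw [show ⟪y, ν⟫ = ⟪y, ∑ i : Fin n, ⟪ν, EuclideanSpace.single i (1:ℝ)⟫ • EuclideanSpace.single i (1:ℝ)⟫ by rw [← sum_single ν]]
      rw [inner_sum, Finset.sum_mul, Finset.mul_sum, Finset.mul_sum]
      refine Finset.sum_congr rfl fun i _ => ?_
      rw [real_inner_smul_right]; ring
    · intro i _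
      exact ((hi _).const_mul _).const_mul _
  rw [e, real_inner_self_eq_norm_sq, hν]
  ring

lemma kink_lower {n : ℕ} {ν : EE n} (hν : ‖ν‖ = 1) (δ : ℝ) :
    (1 / 4) * volume.real (ball (0 : EE n) (1/8)) ≤ ∫ y, max ⟪y, ν⟫ 0 * LPhi ν δ y := by
  rw [kink_LPhi hν]
  have hps := psi_cont (n := n)
  set f : EE n → ℝ := fun y => ({y : EE n | 0 < ⟪y, ν⟫}.indicator 1 y) * (⟪y, ν⟫ * psi y ^ 2) with hfdef
  have hi : Integrable f := by
    have : Integrable fun y : EE n => ⟪y, ν⟫ * psi y ^ 2 :=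
      Continuous.integrable_of_hasCompactSupport (by fun_prop) (psi_comp fun y h => by simp [h])
    have h2 := this.indicator (s := {y : EE n | 0 < ⟪y, ν⟫}) (measurableSet_lt measurable_const (by fun_prop))
    refine h2.congr (Filter.Eventually.of_forall fun y => ?_)
    simp only [Set.indicator_apply, hfdef]
    split_ifs <;> simp
  have hnn : ∀ y, 0 ≤ f y := by
    intro y
    simp only [Set.indicator_apply, hfdef]
    split_ifs with h
    · have : 0 < ⟪y, ν⟫ := h
      simp; positivity
    · simp
  have hb : ∀ y ∈ ball ((1/2 : ℝ) • ν) (1/8), (1/16 : ℝ) ≤ f y := by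
    intro y hy
    rw [mem_ball, dist_eq_norm] at hy
    have h1 : 1/4 ≤ ⟪y, ν⟫ := by
      have e : ⟪y, ν⟫ = ⟪y - (1/2 : ℝ) • ν, ν⟫ + 1/2 := by
        rw [inner_sub_left, real_inner_smul_left, real_inner_self_eq_norm_sq, hν]; ring
      have := (abs_le.1 (abs_real_inner_le_norm (y - (1/2 : ℝ) • ν) ν)).1
      rw [hν] at this
      linarith
    have h2 : ‖y‖ ≤ 5/8 := by
      have := norm_le_norm_sub_add y ((1/2 : ℝ) • ν)
      rw [norm_smul, hν] at this
      norm_num at this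
      norm_num at hy
      linarith
    have h3 : 1/2 ≤ psi y := le_max_of_le_left (by nlinarith [norm_nonneg y])
    have h4 : 1/4 ≤ psi y ^ 2 := by nlinarith
    have h5 : y ∈ {y : EE n | 0 < ⟪y, ν⟫} := by
      show 0 < ⟪y, ν⟫
      linarith
    simp only [hfdef, Set.indicator_of_mem h5, Pi.one_apply, one_mul]
    nlinarith
  have h1 : ∫ y in ball ((1/2 : ℝ) • ν) (1/8), f y ≤ ∫ y, f y :=
    setIntegral_le_integral hi (Filter.Eventually.of_forall hnn)
  have h2 : (1/16) * volume.real (ball ((1/2 : ℝ) • ν) (1/8)) ≤ ∫ y in ball ((1/2 : ℝ) • ν) (1/8), f y :=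
    setIntegral_ge_of_const_le_real measurableSet_ball measure_ball_lt_top.ne hb hi.integrableOn
  have h3 : volume.real (ball ((1/2 : ℝ) • ν) (1/8)) = volume.real (ball (0 : EE n) (1/8)) := by
    simp only [Measure.real]
    rw [Measure.addHaar_ball_center]
  rw [h3] at h2
  have : 0 ≤ volume.real (ball (0 : EE n) (1/8)) := measureReal_nonneg
  linarith
end S11

namespace S11

/-- anisotropic scaling -/
noncomputable def SS {n : ℕ} (ν : EE n) (σ : ℝ) : EE n →L[ℝ] EE n :=
  σ • ContinuousLinearMap.id ℝ (EE n) + (σ ^ 2 - σ) • (innerSL ℝ ν).smulRight ν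

lemma SS_apply {n : ℕ} (ν : EE n) (σ : ℝ) (y : EE n) :
    SS ν σ y = σ • y + ((σ ^ 2 - σ) * ⟪ν, y⟫) • ν := by
  simp [SS, smul_smul]

lemma SS_nu {n : ℕ} {ν : EE n} (hν : ‖ν‖ = 1) (σ : ℝ) : SS ν σ ν = σ ^ 2 • ν := by
  rw [SS_apply, real_inner_self_eq_norm_sq, hν, ← add_smul]; congr 1; ring

lemma SS_inner {n : ℕ} {ν : EE n} (hν : ‖ν‖ = 1) (σ : ℝ) (y : EE n) : ⟪SS ν σ y, ν⟫ = σ ^ 2 * ⟪y, ν⟫ := by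
  rw [SS_apply, inner_add_left, real_inner_smul_left, real_inner_smul_left, real_inner_self_eq_norm_sq, hν,
    real_inner_comm ν y]; ring

lemma SS_norm {n : ℕ} {ν : EE n} (hν : ‖ν‖ = 1) (σ t : ℝ) (y : EE n) :
    ‖t • ν + SS ν σ y‖ ^ 2 = σ ^ 2 * (‖y‖ ^ 2 - ⟪y, ν⟫ ^ 2) + (σ ^ 2 * ⟪y, ν⟫ + t) ^ 2 := by
  have e : t • ν + SS ν σ y = σ • y + (t + (σ ^ 2 - σ) * ⟪y, ν⟫) • ν := by
    rw [SS_apply, add_smul, real_inner_comm ν y]; abel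
  rw [e, norm_add_sq_real, norm_smul, norm_smul, real_inner_smul_left, real_inner_smul_right, hν,
    mul_one, mul_pow, Real.norm_eq_abs, Real.norm_eq_abs, sq_abs, sq_abs]
  ring

lemma bil {n : ℕ} {ν : EE n} (hν : ‖ν‖ = 1) (σ : ℝ) (B : EE n →L[ℝ] EE n →L[ℝ] ℝ)
    (hB : ∑ i : Fin n, B (EuclideanSpace.single i 1) (EuclideanSpace.single i 1) = 0) :
    (1 - σ ^ 2) * B (SS ν σ ν) (SS ν σ ν) +
      ∑ i : Fin n, σ ^ 2 * B (SS ν σ (EuclideanSpace.single i 1)) (SS ν σ (EuclideanSpace.single i 1)) = 0 := by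
  have h1 : ∑ i : Fin n, ⟪ν, EuclideanSpace.single i (1:ℝ)⟫ * B (EuclideanSpace.single i 1) ν = B ν ν := by
    conv_rhs => rw [show B ν ν = B (∑ i : Fin n, ⟪ν, EuclideanSpace.single i (1:ℝ)⟫ • EuclideanSpace.single i (1:ℝ)) ν by rw [← sum_single ν]]
    simp [map_sum]
  have h2 : ∑ i : Fin n, ⟪ν, EuclideanSpace.single i (1:ℝ)⟫ * B ν (EuclideanSpace.single i 1) = B ν ν := by
    conv_rhs => rw [show B ν ν = B ν (∑ i : Fin n, ⟪ν, EuclideanSpace.single i (1:ℝ)⟫ • EuclideanSpace.single i (1:ℝ)) by rw [← sum_single ν]]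
    simp [map_sum]
  have h3 : ∑ i : Fin n, ⟪ν, EuclideanSpace.single i (1:ℝ)⟫ * ⟪ν, EuclideanSpace.single i (1:ℝ)⟫ = 1 := by
    have : ⟪ν, ν⟫ = 1 := by rw [real_inner_self_eq_norm_sq, hν]; norm_num
    refine Eq.trans ?_ this
    conv_rhs => rw [show ⟪ν, ν⟫ = ⟪ν, ∑ i : Fin n, ⟪ν, EuclideanSpace.single i (1:ℝ)⟫ • EuclideanSpace.single i (1:ℝ)⟫ by rw [← sum_single ν]]
    rw [inner_sum]
    exact Finset.sum_congr rfl fun i _ => by rw [real_inner_smul_right]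
  have h4 : ∀ e : EE n, B (SS ν σ e) (SS ν σ e) = σ ^ 2 * B e e +
      (σ * (σ ^ 2 - σ)) * (⟪ν, e⟫ * B e ν) + (σ * (σ ^ 2 - σ)) * (⟪ν, e⟫ * B ν e) +
        ((σ ^ 2 - σ) ^ 2 * B ν ν) * (⟪ν, e⟫ * ⟪ν, e⟫) := by
    intro e
    rw [SS_apply]
    simp only [map_add, map_smul, add_apply, smul_apply, smul_eq_mul]
    ring
  rw [← Finset.mul_sum]
  simp_rw [h4]
  simp_rw [Finset.sum_add_distrib, ← Finset.mul_sum]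
  rw [hB, h1, h2, h3, real_inner_self_eq_norm_sq, hν]
  ring

lemma harm_LPhi {n : ℕ} {ν : EE n} (hν : ‖ν‖ = 1) (σ : ℝ) {F : EE n → ℝ} (hF : ContDiff ℝ 2 F) (p : EE n)
    (hL : ∀ y ∈ ball (0 : EE n) 1, ∑ i : Fin n,
      fderiv ℝ (fderiv ℝ F) (p + SS ν σ y) (EuclideanSpace.single i 1) (EuclideanSpace.single i 1) = 0) :
    ∫ y, F (p + SS ν σ y) * LPhi ν (σ ^ 2) y = 0 := by
  have hFc := hF.continuous
  have hps := psi_cont (n := n)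
  rw [int_LPhi (by fun_prop)]
  simp_rw [green2 hF]
  have hi : ∀ u : EE n, Integrable fun y => fderiv ℝ (fderiv ℝ F) (p + SS ν σ y) (SS ν σ u) (SS ν σ u) * psi y ^ 3 := fun u =>
    ((cont_dd hF _ _ _ _).mul (hps.pow 3)).integrable_of_hasCompactSupport (psi_comp fun y h => by simp [h])
  simp_rw [← integral_const_mul]
  rw [← integral_finsetSum _ fun i _ => (hi _).const_mul _,
    ← integral_add ((hi _).const_mul _) (integrable_finsetSum _ fun i _ => (hi _).const_mul _)]
  refine integral_eq_zero_of_ae (Filter.Eventually.of_forall fun y => ?_)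
  by_cases hy : y ∈ ball (0 : EE n) 1
  · have := bil hν σ _ (hL y hy)
    simp only [Pi.zero_apply]
    simp_rw [← mul_assoc]
    rw [← Finset.sum_mul, ← add_mul, this, zero_mul]
  · simp [psi_zero hy]

lemma SS_inj {n : ℕ} {ν : EE n} (hν : ‖ν‖ = 1) {σ : ℝ} (hσ : 0 < σ) (p : EE n) :
    Function.Injective fun y => p + SS ν σ y := by
  intro x y hxy
  have h : SS ν σ (x - y) = 0 := by
    rw [map_sub, sub_eq_zero]; exact add_left_cancel hxy
  have h1 := SS_inner hν σ (x - y)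
  rw [h, inner_zero_left] at h1
  have h2 : ⟪x - y, ν⟫ = 0 := by
    rcases mul_eq_zero.1 h1.symm with h | h
    · exact absurd h (by positivity)
    · exact h
  rw [SS_apply, real_inner_comm, h2, mul_zero, zero_smul, add_zero, smul_eq_zero] at h
  rcases h with h | h
  · exact absurd h hσ.ne'
  · exact sub_eq_zero.1 h

lemma cov {n : ℕ} {ν : EE n} (hν : ‖ν‖ = 1) {σ : ℝ} (hσ : 0 < σ) (p : EE n) {s : Set (EE n)}
    (hs : MeasurableSet s) (g : EE n → ℝ) :
    ∫ x in (fun y => p + SS ν σ y) '' s, g x = |(SS ν σ).det| * ∫ y in s, g (p + SS ν σ y) := by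
  rw [integral_image_eq_integral_abs_det_fderiv_smul volume hs
    (fun x _ => (aff_deriv p (SS ν σ) x).hasFDerivWithinAt) (SS_inj hν hσ p).injOn]
  simp [integral_const_mul]

/-- maps the closed ball inside -/
lemma T_in {n : ℕ} {ν : EE n} (hν : ‖ν‖ = 1) {σ : ℝ} (hσ : 0 < σ) (hσ1 : σ ^ 2 ≤ 1 / 2) {y : EE n}
    (hy : ‖y‖ ≤ 1) : ‖(1 - 2 * σ ^ 2) • ν + SS ν σ y‖ < 1 - σ ^ 2 / 8 := by
  have h := SS_norm hν σ (1 - 2 * σ ^ 2) y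
  have h1 := abs_real_inner_le_norm y ν
  rw [hν, mul_one] at h1
  have h2 := abs_le.1 (h1.trans hy)
  set a := ⟪y, ν⟫
  set d := σ ^ 2 with hd
  have hd0 : 0 < d := by positivity
  have h3 : (d * a + (1 - 2 * d)) ^ 2 ≤ (1 - d) ^ 2 := by
    apply sq_le_sq'
    · nlinarith
    · nlinarith
  have h4 : ‖y‖ ^ 2 ≤ 1 := pow_le_one₀ (norm_nonneg _) hy
  have h5 : d * (‖y‖ ^ 2 - a ^ 2) ≤ d := by nlinarith [sq_nonneg a]
  refine lt_of_pow_lt_pow_left₀ 2 (by linarith) ?_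
  rw [h]
  nlinarith

lemma T_out {n : ℕ} {ν : EE n} (hν : ‖ν‖ = 1) {σ : ℝ} (hσ : 0 < σ) (hσ1 : σ ^ 2 ≤ 1 / 2) :
    {x : EE n | x ∈ ball (0 : EE n) 1 ∧ 1 - 2 * σ ^ 2 < ⟪x, ν⟫} ⊆
      (fun y => (1 - 2 * σ ^ 2) • ν + SS ν σ y) '' ball (0 : EE n) 3 := by
  rintro x ⟨hx, hxt⟩
  have hx1 : ‖x‖ < 1 := by simpa using hx
  set t := 1 - 2 * σ ^ 2 with ht
  set w := ⟪x, ν⟫ - t with hw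
  set y : EE n := σ⁻¹ • (x - t • ν) + ((σ ^ 2)⁻¹ - σ⁻¹) • w • ν with hy
  have hyn : ⟪ν, y⟫ = (σ ^ 2)⁻¹ * w := by
    rw [hy, inner_add_right, real_inner_smul_right, real_inner_smul_right, real_inner_smul_right,
      inner_sub_right, real_inner_smul_right, real_inner_self_eq_norm_sq, hν, real_inner_comm x ν]
    rw [hw]; ring
  have hT : t • ν + SS ν σ y = x := by
    rw [SS_apply, hyn, hy, smul_add, smul_smul, smul_smul, smul_smul, mul_inv_cancel₀ hσ.ne', one_smul]
    rw [← mul_assoc]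
    rw [show σ * ((σ ^ 2)⁻¹ - σ⁻¹) * w = - ((σ ^ 2 - σ) * (σ ^ 2)⁻¹ * w) by field_simp; ring]
    rw [neg_smul]
    abel
  refine ⟨y, ?_, hT⟩
  have h := SS_norm hν σ t y
  rw [hT, real_inner_comm, hyn] at h
  have hd0 : 0 < σ ^ 2 := by positivity
  have e : σ ^ 2 * ((σ ^ 2)⁻¹ * w) = w := by field_simp
  rw [e] at h
  have hxn : ⟪x, ν⟫ ≤ 1 := by
    have := (abs_le.1 (abs_real_inner_le_norm x ν)).2
    rw [hν] at this; linarith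
  have hw0 : 0 < w := by rw [hw]; linarith
  have hw2 : w ≤ 2 * σ ^ 2 := by rw [hw, ht]; linarith
  have hq0 : 0 ≤ (σ ^ 2)⁻¹ * w := by positivity
  have hq : (σ ^ 2)⁻¹ * w ≤ 2 := by rw [inv_mul_le_iff₀ hd0]; linarith
  have hq2 : ((σ ^ 2)⁻¹ * w) ^ 2 ≤ 4 := by nlinarith
  have ht0 : 0 ≤ t := by rw [ht]; linarith
  have h5 : σ ^ 2 * (‖y‖ ^ 2 - ((σ ^ 2)⁻¹ * w) ^ 2) ≤ σ ^ 2 * 4 := by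
    have : ‖x‖ ^ 2 ≤ 1 := pow_le_one₀ (norm_nonneg _) hx1.le
    have h6 : t ^ 2 ≤ (w + t) ^ 2 := by gcongr; linarith
    have h7 : 1 - t ^ 2 ≤ σ ^ 2 * 4 := by rw [ht]; nlinarith
    linarith
  have h8 := le_of_mul_le_mul_left h5 hd0
  rw [mem_ball_zero_iff]
  refine lt_of_pow_lt_pow_left₀ 2 (by norm_num) ?_
  linarith
end S11

namespace S11

/-- The cap estimate: a kink is quantitatively far from harmonic functions. -/
lemma cap {n : ℕ} {ν : EE n} (hν : ‖ν‖ = 1) {σ : ℝ} (hσ : 0 < σ) (hσ1 : σ ^ 2 ≤ 1 / 2) :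
    ∫ x in ball (0 : EE n) 1, (max (⟪x, ν⟫ - (1 - 2 * σ ^ 2)) 0) ^ 2 ≤
      4 * (σ ^ 2) ^ 2 * (|(SS ν σ).det| * volume.real (ball (0 : EE n) 3)) := by
  set t := 1 - 2 * σ ^ 2 with ht
  set P : Set (EE n) := {x : EE n | x ∈ ball (0 : EE n) 1 ∧ t < ⟪x, ν⟫} with hP
  set T : EE n → EE n := fun y => t • ν + SS ν σ y with hT
  have hsub : P ⊆ T '' ball (0 : EE n) 3 := T_out hν hσ hσ1
  have hPm : MeasurableSet P :=
    measurableSet_ball.inter (isOpen_lt (f := fun _ : EE n => t) (g := fun x : EE n => ⟪x, ν⟫)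
      continuous_const (by fun_prop)).measurableSet
  have hfin : volume (T '' ball (0 : EE n) 3) ≠ ⊤ := by
    have hb : Bornology.IsBounded (T '' ball (0 : EE n) 3) := by
      refine ((isCompact_closedBall (0 : EE n) 3).image (f := T) (by fun_prop)).isBounded.subset ?_
      exact Set.image_mono ball_subset_closedBall
    exact hb.measure_lt_top.ne
  have hvol : volume.real (T '' ball (0 : EE n) 3) = |(SS ν σ).det| * volume.real (ball (0 : EE n) 3) := by
    have := cov hν hσ (t • ν) (s := ball (0 : EE n) 3) measurableSet_ball (fun _ => 1)
    simpa using this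
  rw [← hvol]
  calc ∫ x in ball (0 : EE n) 1, (max (⟪x, ν⟫ - t) 0) ^ 2
      ≤ ∫ x in ball (0 : EE n) 1, P.indicator (fun _ => 4 * (σ ^ 2) ^ 2) x := by
        refine integral_mono_of_nonneg (Filter.Eventually.of_forall fun x => sq_nonneg _)
          ((integrable_const _).indicator hPm) ?_
        filter_upwards [ae_restrict_mem measurableSet_ball] with x hx
        have hx1 : ‖x‖ < 1 := by simpa using hx
        by_cases hxt : t < ⟪x, ν⟫
        · rw [Set.indicator_of_mem (show x ∈ P from ⟨hx, hxt⟩)]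
          have := (abs_le.1 (abs_real_inner_le_norm x ν)).2
          rw [hν] at this
          rw [max_eq_left (by linarith)]
          have h2 : ⟪x, ν⟫ - t ≤ 2 * σ ^ 2 := by rw [ht]; linarith
          nlinarith
        · rw [Set.indicator_of_notMem (show x ∉ P from fun h => hxt h.2)]
          rw [max_eq_right (by linarith)]; norm_num
    _ = 4 * (σ ^ 2) ^ 2 * volume.real P := by
        rw [setIntegral_indicator hPm, setIntegral_const, Set.inter_eq_self_of_subset_right (fun x hx => hx.1)]
        simp [mul_comm]
    _ ≤ _ := by
        gcongr

lemma core_bound {n : ℕ} {ν : EE n} (hν : ‖ν‖ = 1) {σ : ℝ} (hσ : 0 < σ) (hσ1 : σ ^ 2 ≤ 1 / 2)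
    {h : EE n → ℝ} (hh : Harm h) (s : ℝ) (k : EE n → ℝ)
    (hk : k = fun x => h x - s * max (⟪x, ν⟫ - (1 - 2 * σ ^ 2)) 0)
    (hi : Integrable (fun x => k x ^ 2) (volume.restrict (ball (0 : EE n) 1))) :
    |(SS ν σ).det| * (|s| * σ ^ 2 * ((1 / 4) * volume.real (ball (0 : EE n) (1/8)))) ^ 2 ≤
      (30 + 30 * n) ^ 2 * volume.real (ball (0 : EE n) 1) * ∫ x in ball (0 : EE n) 1, k x ^ 2 := by
  set t := 1 - 2 * σ ^ 2 with ht
  set T : EE n → EE n := fun y => t • ν + SS ν σ y with hT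
  have hd0 : 0 < σ ^ 2 := by positivity
  have hTin : ∀ y ∈ closedBall (0 : EE n) 1, T y ∈ ball (0 : EE n) (1 - σ ^ 2 / 8) := by
    intro y hy
    rw [mem_ball_zero_iff]
    exact T_in hν hσ hσ1 (by simpa using hy)
  have hTin1 : ∀ y ∈ closedBall (0 : EE n) 1, T y ∈ ball (0 : EE n) 1 := fun y hy =>
    ball_subset_ball (by linarith) (hTin y hy)
  obtain ⟨F, hF, hFe, hL⟩ := hh.ext (ρ := 1 - σ ^ 2 / 8) (by linarith) (by linarith)
  have hFc := hF.continuous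
  have hTc : Continuous T := by fun_prop
  -- the pulled back function
  have hkc : ContinuousOn k (ball (0 : EE n) 1) := by
    rw [hk]
    exact hh.1.continuousOn.sub (by fun_prop)
  have hkT : ContinuousOn (fun y => k (T y)) (closedBall (0 : EE n) 1) :=
    hkc.comp hTc.continuousOn hTin1
  have hmem : MemLp (fun y => k (T y)) 2 (volume.restrict (ball (0 : EE n) 1)) := by
    rw [memLp_two_iff_integrable_sq]
    · exact ((hkT.pow 2).integrableOn_compact (isCompact_closedBall _ _)).mono_set ball_subset_closedBall
    · exact (hkT.mono ball_subset_closedBall).aestronglyMeasurable measurableSet_ball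
  have h1 := cs hmem
  have hTn : ∀ y, ⟪T y, ν⟫ - t = σ ^ 2 * ⟪y, ν⟫ := by
    intro y
    simp only [hT]
    rw [inner_add_left, SS_inner hν, real_inner_smul_left, real_inner_self_eq_norm_sq, hν]; ring
  -- the duality identity
  have hz : ∫ y, F (T y) * LPhi ν (σ ^ 2) y = 0 :=
    harm_LPhi hν σ hF (t • ν) fun y hy => hL _ (hTin y (ball_subset_closedBall hy))
  have hlow := kink_lower hν (σ ^ 2)
  set κ := (1 / 4) * volume.real (ball (0 : EE n) (1/8)) with hκ
  have hκ0 : 0 ≤ κ := by positivity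
  have hLc := LPhi_cont ν (σ ^ 2)
  have hi1 : Integrable fun y => F (T y) * LPhi ν (σ ^ 2) y :=
    Continuous.integrable_of_hasCompactSupport (by fun_prop) (psi_comp fun y h => by simp [LPhi_zero _ _ y h])
  have hi2 : Integrable fun y => max ⟪y, ν⟫ 0 * LPhi ν (σ ^ 2) y :=
    Continuous.integrable_of_hasCompactSupport (by fun_prop) (psi_comp fun y h => by simp [LPhi_zero _ _ y h])
  have hid : ∫ y, (F (T y) - s * σ ^ 2 * max ⟪y, ν⟫ 0) * LPhi ν (σ ^ 2) y =
      - (s * σ ^ 2 * ∫ y, max ⟪y, ν⟫ 0 * LPhi ν (σ ^ 2) y) := by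
    simp_rw [sub_mul, mul_assoc (s * σ ^ 2)]
    rw [integral_sub hi1 (hi2.const_mul _), hz, integral_const_mul, zero_sub]
  have hintk : Integrable (fun y => |k (T y)|) (volume.restrict (ball (0 : EE n) 1)) :=
    (hmem.integrable (by norm_num)).abs
  have hup : |∫ y, (F (T y) - s * σ ^ 2 * max ⟪y, ν⟫ 0) * LPhi ν (σ ^ 2) y| ≤
      (30 + 30 * n) * ∫ y in ball (0 : EE n) 1, |k (T y)| := by
    have hi3 : Integrable ((ball (0 : EE n) 1).indicator fun y => (30 + 30 * n : ℝ) * |k (T y)|) volume :=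
      (integrable_indicator_iff measurableSet_ball).2 (hintk.const_mul _)
    have := norm_integral_le_of_norm_le
      (f := fun y => (F (T y) - s * σ ^ 2 * max ⟪y, ν⟫ 0) * LPhi ν (σ ^ 2) y) hi3
      (Filter.Eventually.of_forall fun y => ?_)
    · rw [integral_indicator measurableSet_ball, integral_const_mul] at this
      exact this
    · by_cases hy : y ∈ ball (0 : EE n) 1
      · rw [Set.indicator_of_mem hy, norm_mul, mul_comm]
        have e : F (T y) - s * σ ^ 2 * max ⟪y, ν⟫ 0 = k (T y) := by
          rw [hk, hFe _ (hTin y (ball_subset_closedBall hy))]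
          simp only
          rw [hTn, mul_assoc, mul_max_of_nonneg _ _ hd0.le, mul_zero]
        rw [e]
        exact mul_le_mul_of_nonneg_right (LPhi_bound hν hd0.le (by linarith) y) (abs_nonneg _)
      · rw [Set.indicator_of_notMem hy, LPhi_zero _ _ y (psi_zero hy)]; simp
  rw [hid, abs_neg, abs_mul, abs_mul, abs_of_pos hd0] at hup
  have hup2 : |s| * σ ^ 2 * κ ≤ (30 + 30 * n) * ∫ y in ball (0 : EE n) 1, |k (T y)| := by
    refine le_trans ?_ hup
    gcongr
    exact hlow.trans (le_abs_self _)
  set J := |(SS ν σ).det| with hJ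
  have hJ0 : 0 ≤ J := abs_nonneg _
  have hcov := cov hν hσ (t • ν) (s := ball (0 : EE n) 1) measurableSet_ball (fun x => k x ^ 2)
  have hle : J * ∫ y in ball (0 : EE n) 1, k (T y) ^ 2 ≤ ∫ x in ball (0 : EE n) 1, k x ^ 2 := by
    rw [← hcov]
    refine setIntegral_mono_set hi (Filter.Eventually.of_forall fun x => sq_nonneg _) ?_
    refine Filter.Eventually.of_forall ?_
    rintro _ ⟨y, hy, rfl⟩
    exact hTin1 y (ball_subset_closedBall hy)
  have hV : (volume.restrict (ball (0 : EE n) 1)).real Set.univ = volume.real (ball (0 : EE n) 1) := by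
    simp [Measure.real]
  rw [hV] at h1
  have hV0 : 0 ≤ volume.real (ball (0 : EE n) 1) := measureReal_nonneg
  set V := volume.real (ball (0 : EE n) 1)
  set M : ℝ := 30 + 30 * n
  calc J * (|s| * σ ^ 2 * κ) ^ 2 ≤ J * (M * ∫ y in ball (0 : EE n) 1, |k (T y)|) ^ 2 := by gcongr
    _ = J * M ^ 2 * (∫ y in ball (0 : EE n) 1, |k (T y)|) ^ 2 := by ring
    _ ≤ J * M ^ 2 * (V * ∫ y in ball (0 : EE n) 1, k (T y) ^ 2) := by gcongr
    _ = M ^ 2 * V * (J * ∫ y in ball (0 : EE n) 1, k (T y) ^ 2) := by ring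
    _ ≤ _ := by gcongr

lemma core {n : ℕ} : ∃ C : ℝ, 0 < C ∧ ∀ h : EE n → ℝ, Harm h →
    Integrable (fun x => h x ^ 2) (volume.restrict (ball (0 : EE n) 1)) →
    ∀ (ν : EE n) (t s : ℝ), ‖ν‖ = 1 → 0 ≤ t →
    ∫ x in ball (0 : EE n) 1, h x ^ 2 ≤
      C * ∫ x in ball (0 : EE n) 1, (h x - s * max (⟪x, ν⟫ - t) 0) ^ 2 := by
  set κ := (1 / 4) * volume.real (ball (0 : EE n) (1/8)) with hκ
  have hκ0 : 0 < κ := by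
    have : 0 < volume.real (ball (0 : EE n) (1/8)) :=
      ENNReal.toReal_pos (measure_ball_pos _ _ (by norm_num)).ne' measure_ball_lt_top.ne
    positivity
  set V := volume.real (ball (0 : EE n) 1) with hV
  set V3 := volume.real (ball (0 : EE n) 3) with hV3
  set M : ℝ := 30 + 30 * n with hM
  have hV0 : 0 ≤ V := measureReal_nonneg
  have hV30 : 0 ≤ V3 := measureReal_nonneg
  refine ⟨2 + 8 * V3 * M ^ 2 * V / κ ^ 2, by positivity, fun h hh hi ν t s hν ht0 => ?_⟩
  have hml := hh.memLp hi
  have hg : MemLp (fun x : EE n => s * max (⟪x, ν⟫ - t) 0) 2 (volume.restrict (ball (0 : EE n) 1)) := by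
    have hc : Continuous (fun x : EE n => s * max (⟪x, ν⟫ - t) 0) := by fun_prop
    rw [memLp_two_iff_integrable_sq hc.aestronglyMeasurable]
    exact ((hc.pow 2).continuousOn.integrableOn_compact (isCompact_closedBall _ _)).mono_set ball_subset_closedBall
  have hk := (hml.sub hg).integrable_sq
  simp only [Pi.sub_apply] at hk
  have hkn : 0 ≤ ∫ x in ball (0 : EE n) 1, (h x - s * max (⟪x, ν⟫ - t) 0) ^ 2 :=
    integral_nonneg fun x => sq_nonneg _
  by_cases ht : t < 1
  · obtain ⟨σ, hσ, hσt⟩ : ∃ σ : ℝ, 0 < σ ∧ σ ^ 2 = (1 - t) / 2 :=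
      ⟨Real.sqrt ((1 - t) / 2), Real.sqrt_pos.2 (by linarith), Real.sq_sqrt (by linarith)⟩
    have hσ1 : σ ^ 2 ≤ 1 / 2 := by linarith
    obtain rfl : t = 1 - 2 * σ ^ 2 := by linarith
    have h1 := cap hν hσ hσ1
    have h2 := core_bound hν hσ hσ1 hh s _ rfl hk
    set J := |(SS ν σ).det| with hJ
    set K := ∫ x in ball (0 : EE n) 1, (h x - s * max (⟪x, ν⟫ - (1 - 2 * σ ^ 2)) 0) ^ 2 with hK
    set G := ∫ x in ball (0 : EE n) 1, (max (⟪x, ν⟫ - (1 - 2 * σ ^ 2)) 0) ^ 2 with hG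
    have h3 : s ^ 2 * G ≤ 4 * V3 * M ^ 2 * V / κ ^ 2 * K := by
      rw [div_mul_eq_mul_div, le_div_iff₀ (by positivity)]
      calc s ^ 2 * G * κ ^ 2 ≤ s ^ 2 * (4 * (σ ^ 2) ^ 2 * (J * V3)) * κ ^ 2 := by gcongr
        _ = 4 * V3 * (J * (|s| * σ ^ 2 * κ) ^ 2) := by
          rw [← sq_abs s]; ring
        _ ≤ 4 * V3 * (M ^ 2 * V * K) := by gcongr
        _ = _ := by ring
    have h4 : ∫ x in ball (0 : EE n) 1, h x ^ 2 ≤ ∫ x in ball (0 : EE n) 1,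
        (2 * (h x - s * max (⟪x, ν⟫ - (1 - 2 * σ ^ 2)) 0) ^ 2 +
          2 * (s * max (⟪x, ν⟫ - (1 - 2 * σ ^ 2)) 0) ^ 2) := by
      refine integral_mono hi ((hk.const_mul 2).add (hg.integrable_sq.const_mul 2)) fun x => ?_
      simp only
      nlinarith [sq_nonneg (h x - 2 * (s * max (⟪x, ν⟫ - (1 - 2 * σ ^ 2)) 0))]
    rw [integral_add (hk.const_mul 2) (hg.integrable_sq.const_mul 2), integral_const_mul, integral_const_mul] at h4
    simp_rw [mul_pow] at h4
    rw [integral_const_mul] at h4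
    calc _ ≤ 2 * K + 2 * (s ^ 2 * G) := h4
      _ ≤ 2 * K + 2 * (4 * V3 * M ^ 2 * V / κ ^ 2 * K) := by gcongr
      _ = _ := by ring
  · have e : ∫ x in ball (0 : EE n) 1, (h x - s * max (⟪x, ν⟫ - t) 0) ^ 2 = ∫ x in ball (0 : EE n) 1, h x ^ 2 := by
      refine setIntegral_congr_fun measurableSet_ball fun x hx => ?_
      have hx1 : ‖x‖ < 1 := by simpa using hx
      have := (abs_le.1 (abs_real_inner_le_norm x ν)).2
      rw [hν] at this
      rw [max_eq_right (by linarith)]; ring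
    rw [e] at hkn ⊢
    have : 0 ≤ 8 * V3 * M ^ 2 * V / κ ^ 2 := by positivity
    nlinarith [mul_nonneg this hkn]

lemma Harm.sub_aff {n : ℕ} {v : EE n → ℝ} (hv : Harm v) (a : ℝ) (b : EE n) :
    Harm (fun x => v x - (a + ⟪b, x⟫)) ∧ ∀ x ∈ ball (0 : EE n) 1,
      fderiv ℝ (fun x => v x - (a + ⟪b, x⟫)) x = fderiv ℝ v x - innerSL ℝ b := by
  have hd : ∀ x ∈ ball (0 : EE n) 1,
      fderiv ℝ (fun x => v x - (a + ⟪b, x⟫)) x = fderiv ℝ v x - innerSL ℝ b := by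
    intro x hx
    have h1 := ((hv.1.contDiffAt (isOpen_ball.mem_nhds hx)).differentiableAt (by norm_num)).hasFDerivAt
    have h2 : HasFDerivAt (fun x : EE n => a + ⟪b, x⟫) (innerSL ℝ b) x :=
      ((innerSL ℝ b).hasFDerivAt (x := x)).const_add a
    exact (h1.sub h2).fderiv
  refine ⟨⟨hv.1.sub (ContDiff.contDiffOn (contDiff_const.add (contDiff_const.inner ℝ contDiff_id))), fun x hx => ?_⟩, hd⟩
  have e : fderiv ℝ (fun x => v x - (a + ⟪b, x⟫)) =ᶠ[nhds x] fun x => fderiv ℝ v x - innerSL ℝ b := by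
    filter_upwards [isOpen_ball.mem_nhds hx] with y hy using hd y hy
  rw [e.fderiv_eq, fderiv_sub_const]
  exact hv.2 x hx

/-- The statement for kinks in normal form with `0 ≤ t`. -/
lemma normal {n : ℕ} : ∃ η : ℝ, 0 < η ∧ ∀ v : EE n → ℝ, Harm v →
    ∀ (ν : EE n) (t s a : ℝ) (b : EE n), ‖ν‖ = 1 → 0 ≤ t →
    η * ∫ x in ball (0 : EE n) 1, (v x - (v 0 + fderiv ℝ v 0 x)) ^ 2 ≤
      ∫ x in ball (0 : EE n) 1, (v x - (a + ⟪b, x⟫ + s * max (⟪x, ν⟫ - t) 0)) ^ 2 := by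
  obtain ⟨C1, hC1, H1⟩ := lin_bound (n := n)
  obtain ⟨C2, hC2, H2⟩ := core (n := n)
  refine ⟨(C1 * C2)⁻¹, by positivity, fun v hv ν t s a b hν ht => ?_⟩
  have hR : 0 ≤ ∫ x in ball (0 : EE n) 1, (v x - (a + ⟪b, x⟫ + s * max (⟪x, ν⟫ - t) 0)) ^ 2 :=
    integral_nonneg fun x => sq_nonneg _
  by_cases hintg : Integrable (fun x => (v x - (v 0 + fderiv ℝ v 0 x)) ^ 2) (volume.restrict (ball (0 : EE n) 1))
  · obtain ⟨hh, hd⟩ := hv.sub_aff a b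
    have hd0 := hd 0 (by simp)
    set h : EE n → ℝ := fun x => v x - (a + ⟪b, x⟫) with hh_def
    have hm1 : MemLp (fun x => v x - (v 0 + fderiv ℝ v 0 x)) 2 (volume.restrict (ball (0 : EE n) 1)) := by
      rw [memLp_two_iff_integrable_sq]
      · exact hintg
      · exact (hv.1.continuousOn.sub (by fun_prop)).aestronglyMeasurable measurableSet_ball
    have hm2 : MemLp (fun x : EE n => (v 0 + fderiv ℝ v 0 x) - (a + ⟪b, x⟫)) 2 (volume.restrict (ball (0 : EE n) 1)) := by
      have hc : Continuous (fun x : EE n => (v 0 + fderiv ℝ v 0 x) - (a + ⟪b, x⟫)) := by fun_prop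
      rw [memLp_two_iff_integrable_sq hc.aestronglyMeasurable]
      exact ((hc.pow 2).continuousOn.integrableOn_compact (isCompact_closedBall _ _)).mono_set ball_subset_closedBall
    have hi : Integrable (fun x => h x ^ 2) (volume.restrict (ball (0 : EE n) 1)) := by
      refine (hm1.add hm2).integrable_sq.congr (Filter.Eventually.of_forall fun x => ?_)
      simp [hh_def]
    have k1 := H1 h hh hi
    have k2 := H2 h hh hi ν t s hν ht
    have e1 : ∀ x, h x - (h 0 + fderiv ℝ h 0 x) = v x - (v 0 + fderiv ℝ v 0 x) := by
      intro x
      rw [hd0]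
      simp [hh_def]
      ring
    have e2 : ∀ x, h x - s * max (⟪x, ν⟫ - t) 0 = v x - (a + ⟪b, x⟫ + s * max (⟪x, ν⟫ - t) 0) := by
      intro x
      simp only [hh_def]; ring
    simp_rw [e1] at k1
    simp_rw [e2] at k2
    rw [inv_mul_le_iff₀ (by positivity), mul_assoc]
    exact k1.trans (by gcongr)
  · rw [integral_undef hintg, mul_zero]; exact hR

end S11

/-- There is `η = η(n) > 0` such that for every harmonic `v` on the unit ball of `ℝⁿ`
with `∫_{B₁} |v|² ≤ 1` and every continuous piecewise-affine competitor `l` whose graph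
is a union of two half-hyperplanes meeting along an `(n-1)`-dimensional axis
(`l(x) = a₁ + ⟪b₁,x⟫` on `{⟪x,ν⟫ ≤ t}` and `l(x) = a₂ + ⟪b₂,x⟫` on the complementary
half-space, agreeing on the hyperplane `{⟪x,ν⟫ = t}`), one has
`η ∫_{B₁} |v - (v(0) + Dv(0)·x)|² ≤ ∫_{B₁} |v - l|²`. -/
theorem stmt_11 (n : ℕ) :
    ∃ η : ℝ, 0 < η ∧
      ∀ v : EuclideanSpace ℝ (Fin n) → ℝ,
        ContDiffOn ℝ 2 v (ball 0 1) →
        (∀ x ∈ ball (0 : EuclideanSpace ℝ (Fin n)) 1, ∑ i : Fin n,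
          iteratedFDerivWithin ℝ 2 v (ball 0 1) x
            ![EuclideanSpace.single i 1, EuclideanSpace.single i 1] = 0) →
        (∫ x in ball (0 : EuclideanSpace ℝ (Fin n)) 1, (v x) ^ 2) ≤ 1 →
        ∀ (ν : EuclideanSpace ℝ (Fin n)) (t a₁ a₂ : ℝ)
          (b₁ b₂ : EuclideanSpace ℝ (Fin n)),
          ‖ν‖ = 1 →
          (∀ x : EuclideanSpace ℝ (Fin n), ⟪x, ν⟫ = t →
            a₁ + ⟪b₁, x⟫ = a₂ + ⟪b₂, x⟫) →
          η * ∫ x in ball (0 : EuclideanSpace ℝ (Fin n)) 1,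
              (v x - (v 0 + fderivWithin ℝ v (ball 0 1) 0 x)) ^ 2 ≤
            ∫ x in ball (0 : EuclideanSpace ℝ (Fin n)) 1,
              (v x - (if ⟪x, ν⟫ ≤ t then a₁ + ⟪b₁, x⟫ else a₂ + ⟪b₂, x⟫)) ^ 2 := by
  obtain ⟨η, hη, H⟩ := S11.normal (n := n)
  refine ⟨η, hη, fun v hv hlap _ ν t a₁ a₂ b₁ b₂ hν hag => ?_⟩
  have hharm : S11.Harm v := by
    refine ⟨hv, fun x hx => ?_⟩
    rw [← hlap x hx]
    refine Finset.sum_congr rfl fun i _ => ?_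
    rw [iteratedFDerivWithin_of_isOpen 2 isOpen_ball hx, iteratedFDeriv_two_apply]
    simp
  have h0 : (0 : EuclideanSpace ℝ (Fin n)) ∈ ball (0 : EuclideanSpace ℝ (Fin n)) 1 := by simp
  rw [fderivWithin_of_isOpen isOpen_ball h0]
  -- the jump of slopes
  have hjump : ∀ x : EuclideanSpace ℝ (Fin n),
      a₂ + ⟪b₂, x⟫ = a₁ + ⟪b₁, x⟫ + ⟪b₂ - b₁, ν⟫ * (⟪x, ν⟫ - t) := by
    intro x
    have := hag (x - (⟪x, ν⟫ - t) • ν) (by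
      rw [inner_sub_left, real_inner_smul_left, real_inner_self_eq_norm_sq, hν]; ring)
    rw [inner_sub_right, inner_sub_right, real_inner_smul_right, real_inner_smul_right] at this
    rw [inner_sub_left]
    linarith
  rcases le_total 0 t with ht | ht
  · refine (H v hharm ν t ⟪b₂ - b₁, ν⟫ a₁ b₁ hν ht).trans (le_of_eq ?_)
    refine integral_congr_ae (Filter.Eventually.of_forall fun x => ?_)
    simp only
    congr 2
    split_ifs with hx
    · rw [max_eq_right (by linarith)]; ring
    · rw [max_eq_left (by linarith), hjump x]
  · refine (H v hharm (-ν) (-t) ⟪b₂ - b₁, ν⟫ a₂ b₂ (by simpa using hν) (by linarith)).trans (le_of_eq ?_)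
    refine integral_congr_ae (Filter.Eventually.of_forall fun x => ?_)
    simp only [inner_neg_right]
    congr 2
    split_ifs with hx
    · rw [max_eq_left (by linarith), hjump x]; ring
    · rw [max_eq_right (by linarith)]; ring
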